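/- Let $m,n$ be positive integers with $m$ even, $n$ odd and $m\ge 2n$. Then each of the four points $(1,0,0)$, $(-1,0,0)$, $(0,0,1)$ and $(0,0,-1)$ is an extreme point of the unit ball $\mathsf{B}^h_{m,n}$. -/

import Mathlib

open Set

/-- The homogeneous trinomial norm `⦀(a,b,c)⦀_{m,n}`:
the sup of `|a x^m + b x^{m-n} y^n + c y^m|` over the unit square. -/
noncomputable def homNorm (m n : ℕ) (a b c : ℝ) : ℝ :=
  sSup ((fun p : ℝ × ℝ => |a * p.1 ^ m + b * p.1 ^ (m - n) * p.2 ^ n + c * p.2 ^ m|) ''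
    (Icc (-1 : ℝ) 1 ×ˢ Icc (-1 : ℝ) 1))

/-- The closed unit ball of the homogeneous trinomial norm. -/
noncomputable def homBall (m n : ℕ) : Set (ℝ × ℝ × ℝ) :=
  {p | homNorm m n p.1 p.2.1 p.2.2 ≤ 1}

/-- Every value of the trinomial on the unit square is bounded by its norm. -/
theorem abs_trinomial_le_homNorm (m n : ℕ) (a b c : ℝ) {x y : ℝ}
    (hx : x ∈ Icc (-1 : ℝ) 1) (hy : y ∈ Icc (-1 : ℝ) 1) :
    |a * x ^ m + b * x ^ (m - n) * y ^ n + c * y ^ m| ≤ homNorm m n a b c := by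
  refine le_csSup ?_ ⟨(x, y), ⟨hx, hy⟩, rfl⟩
  refine ((isCompact_Icc.prod isCompact_Icc).image_of_continuousOn ?_).bddAbove
  exact Continuous.continuousOn (by fun_prop)

/-- The norm is at most any bound for the trinomial on the unit square. -/
theorem homNorm_le (m n : ℕ) {a b c r : ℝ}
    (h : ∀ x ∈ Icc (-1 : ℝ) 1, ∀ y ∈ Icc (-1 : ℝ) 1,
      |a * x ^ m + b * x ^ (m - n) * y ^ n + c * y ^ m| ≤ r) :
    homNorm m n a b c ≤ r := by
  refine csSup_le ⟨_, (0, 0), by simp, rfl⟩ ?_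
  rintro _ ⟨⟨x, y⟩, ⟨hx, hy⟩, rfl⟩
  exact h x hx y hy

theorem abs_pow_le_one_of_mem_Icc {x : ℝ} (hx : x ∈ Icc (-1 : ℝ) 1) (m : ℕ) : |x ^ m| ≤ 1 := by
  rw [abs_pow]
  exact pow_le_one₀ (abs_nonneg x) (abs_le.2 hx)

/-- The values at `(1, 0)`, `(0, 1)`, `(1, 1)` and `(-1, 1)` bound the coefficients of a trinomial
in the unit ball. -/
theorem bounds_of_mem_homBall {m n : ℕ} (hm : Even m) (hn : Odd n) (h2n : 2 * n ≤ m)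
    {p : ℝ × ℝ × ℝ} (hp : p ∈ homBall m n) :
    |p.1| ≤ 1 ∧ |p.2.2| ≤ 1 ∧ |p.1 + p.2.1 + p.2.2| ≤ 1 ∧ |p.1 - p.2.1 + p.2.2| ≤ 1 := by
  have hn0 : n ≠ 0 := hn.pos.ne'
  have hm0 : m ≠ 0 := by have := hn.pos; omega
  have hmn0 : m - n ≠ 0 := by have := hn.pos; omega
  have hmn : Odd (m - n) := Nat.Even.sub_odd (by omega) hm hn
  have key {x y : ℝ} (hx : x ∈ Icc (-1 : ℝ) 1) (hy : y ∈ Icc (-1 : ℝ) 1) :=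
    (abs_trinomial_le_homNorm m n p.1 p.2.1 p.2.2 hx hy).trans hp
  have h0 : (0 : ℝ) ∈ Icc (-1 : ℝ) 1 := by norm_num
  have h1 : (1 : ℝ) ∈ Icc (-1 : ℝ) 1 := by norm_num
  have h2 : (-1 : ℝ) ∈ Icc (-1 : ℝ) 1 := by norm_num
  refine ⟨?_, ?_, ?_, ?_⟩
  · simpa [hm0, hn0] using key h1 h0
  · simpa [hm0, hmn0] using key h0 h1
  · simpa using key h1 h1
  · simpa [hm.neg_one_pow, hmn.neg_one_pow, sub_eq_add_neg] using key h2 h1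

/-- If a convex combination with positive weights attains a common upper bound, so does its first
term. -/
theorem eq_of_convex_comb_eq_upper_bound {s t x y k : ℝ} (hs : 0 < s) (ht : 0 < t)
    (hst : s + t = 1) (hx : x ≤ k) (hy : y ≤ k) (h : s * x + t * y = k) : x = k := by
  obtain rfl : t = 1 - s := by linarith
  refine le_antisymm hx ?_
  nlinarith [mul_nonneg ht.le (sub_nonneg.2 hy)]

theorem eq_of_convex_comb_eq_lower_bound {s t x y k : ℝ} (hs : 0 < s) (ht : 0 < t)
    (hst : s + t = 1) (hx : k ≤ x) (hy : k ≤ y) (h : s * x + t * y = k) : x = k :=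
  neg_injective <| eq_of_convex_comb_eq_upper_bound hs ht hst
    (neg_le_neg hx) (neg_le_neg hy) (by linarith)

theorem stmt17 (m n : ℕ) (hm : Even m) (hn : Odd n) (h2n : 2 * n ≤ m) :
    ((1 : ℝ), (0 : ℝ), (0 : ℝ)) ∈ Set.extremePoints ℝ (homBall m n) ∧
    ((-1 : ℝ), (0 : ℝ), (0 : ℝ)) ∈ Set.extremePoints ℝ (homBall m n) ∧
    ((0 : ℝ), (0 : ℝ), (1 : ℝ)) ∈ Set.extremePoints ℝ (homBall m n) ∧
    ((0 : ℝ), (0 : ℝ), (-1 : ℝ)) ∈ Set.extremePoints ℝ (homBall m n) := by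
  refine ⟨?_, ?_, ?_, ?_⟩
  · refine ⟨homNorm_le m n fun x hx y hy => ?_, ?_⟩
    · simpa using abs_pow_le_one_of_mem_Icc hx m
    rintro ⟨a, b, c⟩ hp ⟨a', b', c'⟩ hq ⟨s, t, hs, ht, hst, h⟩
    obtain ⟨ha, hc, hadd, hsub⟩ := bounds_of_mem_homBall hm hn h2n hp
    obtain ⟨ha', hc', hadd', hsub'⟩ := bounds_of_mem_homBall hm hn h2n hq
    simp only [Prod.smul_mk, Prod.mk_add_mk, Prod.mk.injEq, smul_eq_mul, abs_le] at *
    obtain ⟨h1, h2, h3⟩ := h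
    have e1 := eq_of_convex_comb_eq_upper_bound hs ht hst ha.2 ha'.2 h1
    have e2 := eq_of_convex_comb_eq_upper_bound hs ht hst hadd.2 hadd'.2 (by linarith)
    have e3 := eq_of_convex_comb_eq_upper_bound hs ht hst hsub.2 hsub'.2 (by linarith)
    exact ⟨by linarith, by linarith, by linarith⟩
  · refine ⟨homNorm_le m n fun x hx y hy => ?_, ?_⟩
    · simpa using abs_pow_le_one_of_mem_Icc hx m
    rintro ⟨a, b, c⟩ hp ⟨a', b', c'⟩ hq ⟨s, t, hs, ht, hst, h⟩
    obtain ⟨ha, hc, hadd, hsub⟩ := bounds_of_mem_homBall hm hn h2n hp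
    obtain ⟨ha', hc', hadd', hsub'⟩ := bounds_of_mem_homBall hm hn h2n hq
    simp only [Prod.smul_mk, Prod.mk_add_mk, Prod.mk.injEq, smul_eq_mul, abs_le] at *
    obtain ⟨h1, h2, h3⟩ := h
    have e1 := eq_of_convex_comb_eq_lower_bound hs ht hst ha.1 ha'.1 h1
    have e2 := eq_of_convex_comb_eq_lower_bound hs ht hst hadd.1 hadd'.1 (by linarith)
    have e3 := eq_of_convex_comb_eq_lower_bound hs ht hst hsub.1 hsub'.1 (by linarith)
    exact ⟨by linarith, by linarith, by linarith⟩
  · refine ⟨homNorm_le m n fun x hx y hy => ?_, ?_⟩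
    · simpa using abs_pow_le_one_of_mem_Icc hy m
    rintro ⟨a, b, c⟩ hp ⟨a', b', c'⟩ hq ⟨s, t, hs, ht, hst, h⟩
    obtain ⟨ha, hc, hadd, hsub⟩ := bounds_of_mem_homBall hm hn h2n hp
    obtain ⟨ha', hc', hadd', hsub'⟩ := bounds_of_mem_homBall hm hn h2n hq
    simp only [Prod.smul_mk, Prod.mk_add_mk, Prod.mk.injEq, smul_eq_mul, abs_le] at *
    obtain ⟨h1, h2, h3⟩ := h
    have e1 := eq_of_convex_comb_eq_upper_bound hs ht hst hc.2 hc'.2 h3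
    have e2 := eq_of_convex_comb_eq_upper_bound hs ht hst hadd.2 hadd'.2 (by linarith)
    have e3 := eq_of_convex_comb_eq_upper_bound hs ht hst hsub.2 hsub'.2 (by linarith)
    exact ⟨by linarith, by linarith, by linarith⟩
  · refine ⟨homNorm_le m n fun x hx y hy => ?_, ?_⟩
    · simpa using abs_pow_le_one_of_mem_Icc hy m
    rintro ⟨a, b, c⟩ hp ⟨a', b', c'⟩ hq ⟨s, t, hs, ht, hst, h⟩
    obtain ⟨ha, hc, hadd, hsub⟩ := bounds_of_mem_homBall hm hn h2n hp
    obtain ⟨ha', hc', hadd', hsub'⟩ := bounds_of_mem_homBall hm hn h2n hq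
    simp only [Prod.smul_mk, Prod.mk_add_mk, Prod.mk.injEq, smul_eq_mul, abs_le] at *
    obtain ⟨h1, h2, h3⟩ := h
    have e1 := eq_of_convex_comb_eq_lower_bound hs ht hst hc.1 hc'.1 h3
    have e2 := eq_of_convex_comb_eq_lower_bound hs ht hst hadd.1 hadd'.1 (by linarith)
    have e3 := eq_of_convex_comb_eq_lower_bound hs ht hst hsub.1 hsub'.1 (by linarith)
    exact ⟨by linarith, by linarith, by linarith⟩
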